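/- arXiv:2003.06526 — 2 statements merged into one kernel-verified Lean document; each statement's English description precedes it below -/
import Mathlib

section
/- The effective scaling map Υ is a bijection from 𝓕 onto 𝒞^I, with inverse given by the spatial reconstruction map Γ; that is, Γ(Υ(ψ)) = ψ for all ψ ∈ 𝓕 and Υ(Γ(ψ̄)) = ψ̄ for all ψ̄ ∈ 𝒞^I. -/
open Set Filter

noncomputable section

/-- `f ∈ 𝒞`: continuous, non-decreasing, `ℝ₊`-valued on `ℝ₊`, with `f 0 = 0`. -/
def memC (f : ℝ → ℝ) : Prop :=
  ContinuousOn f (Ici 0) ∧ MonotoneOn f (Ici 0) ∧ f 0 = 0 ∧ ∀ u ∈ Ici (0:ℝ), 0 ≤ f u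

/-- `f ∈ 𝒞^↑`: member of `𝒞` that is strictly increasing and tends to `∞` at `∞`. -/
def memCup (f : ℝ → ℝ) : Prop :=
  memC f ∧ StrictMonoOn f (Ici 0) ∧ Tendsto f atTop atTop

/-- the soliton size associated with the index `i : Fin I`, namely `i+1`, as a real number. -/
def sz {I : ℕ} (i : Fin I) : ℝ := (i : ℕ) + 1

/-- the effective-distance (integrated slot density) function `φ_i`. -/
def phi {I : ℕ} (ψ : Fin I → ℝ → ℝ) (i : Fin I) (u : ℝ) : ℝ :=
  u - ∑ j, 2 * min (sz i) (sz j) * ψ j u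

/-- the top effective-distance function `φ_I` (note `min (I, j) = j` for `j ≤ I`). -/
def phiTop {I : ℕ} (ψ : Fin I → ℝ → ℝ) (u : ℝ) : ℝ :=
  u - ∑ j, 2 * sz j * ψ j u

/-- `ψ ∈ 𝓕`. -/
def memF {I : ℕ} (ψ : Fin I → ℝ → ℝ) : Prop :=
  (∀ i, memC (ψ i)) ∧ memCup (phiTop ψ)

/-- the inverse of `f : ℝ₊ → ℝ₊` (as a function `ℝ → ℝ` supported in domain `Ici 0`). -/
def rinv (f : ℝ → ℝ) : ℝ → ℝ := Function.invFunOn f (Ici 0)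

/-- the effective scaling (scattering) map `Υ`. -/
def Upsilon {I : ℕ} (ψ : Fin I → ℝ → ℝ) : Fin I → ℝ → ℝ :=
  fun i => ψ i ∘ rinv (phi ψ i)

/-- `gammaK ψb k = γ_{I-k}`, defined by downward recursion from `γ_I = id`:
`γ_i(z) = z + ∑_{j>i} 2(j-i) ψb_j (γ_j z)`. -/
def gammaK {I : ℕ} (ψb : Fin I → ℝ → ℝ) : ℕ → ℝ → ℝ
  | 0 => fun z => z
  | k + 1 => fun z =>
      z + ∑ m ∈ (Finset.range (k + 1)).attach,
        2 * (((k + 1 : ℕ) : ℝ) - ((m : ℕ) : ℝ)) *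
          (if h : (m : ℕ) < I then
              ψb ⟨I - 1 - (m : ℕ), by omega⟩ (gammaK ψb (m : ℕ) z)
            else 0)
  termination_by k => k
  decreasing_by have hm := Finset.mem_range.mp m.2; omega

/-- `γ_i`, for `i = 0, 1, …, I`. -/
def gam {I : ℕ} (ψb : Fin I → ℝ → ℝ) (i : ℕ) : ℝ → ℝ := gammaK ψb (I - i)

/-- the spatial reconstruction (inverse scattering) map `Γ`. -/
def Gamma {I : ℕ} (ψb : Fin I → ℝ → ℝ) : Fin I → ℝ → ℝ :=
  fun i => ψb i ∘ gam ψb ((i : ℕ) + 1) ∘ rinv (gam ψb 0)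

/-- the free-evolution shift `θ_t`. -/
def theta {I : ℕ} (t : ℝ) (ψb : Fin I → ℝ → ℝ) : Fin I → ℝ → ℝ :=
  fun i z => ψb i (max (z - sz i * t) 0)

/-- `ψ ∈ 𝒟`: member of `𝓕` satisfying the density condition
`∑_i i · sup_{u₁≠u₂} (ψ_i(u₁)-ψ_i(u₂))/(φ_i(u₁)-φ_i(u₂)) < 1/2`. -/
def memD {I : ℕ} (ψ : Fin I → ℝ → ℝ) : Prop :=
  memF ψ ∧
  ∃ c : Fin I → ℝ,
    (∀ i, ∀ u₁ ∈ Ici (0:ℝ), ∀ u₂ ∈ Ici (0:ℝ), u₂ < u₁ →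
      ψ i u₁ - ψ i u₂ ≤ c i * (phi ψ i u₁ - phi ψ i u₂)) ∧
    ∑ i, sz i * c i < 1 / 2

/-- `ψb ∈ 𝒟̄`: member of `𝒞^I` satisfying the density condition
`∑_i i · sup_{z₁≠z₂} (ψb_i(z₁)-ψb_i(z₂))/(z₁-z₂) < 1/2`. -/
def memDbar {I : ℕ} (ψb : Fin I → ℝ → ℝ) : Prop :=
  (∀ i, memC (ψb i)) ∧
  ∃ c : Fin I → ℝ,
    (∀ i, ∀ z₁ ∈ Ici (0:ℝ), ∀ z₂ ∈ Ici (0:ℝ), z₂ < z₁ →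
      ψb i z₁ - ψb i z₂ ≤ c i * (z₁ - z₂)) ∧
    ∑ i, sz i * c i < 1 / 2

/-- the extension `f^ℝ` of `f` to `ℝ`, by `0` on the negative half-line. -/
def extZ (f : ℝ → ℝ) : ℝ → ℝ := fun u => if 0 ≤ u then f u else 0

/-- the extension `f^{ℝ,↑}` of `f` to `ℝ`, by the identity on the negative half-line. -/
def extId (f : ℝ → ℝ) : ℝ → ℝ := fun u => if 0 ≤ u then f u else u

/-- `f ∈ 𝒞^q`. -/
def memCq (q : ℕ) (f : ℝ → ℝ) : Prop := memC f ∧ ContDiff ℝ q (extZ f)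

/-- `f ∈ 𝒞^{↑,q}`. -/
def memCupq (q : ℕ) (f : ℝ → ℝ) : Prop := memCup f ∧ ContDiff ℝ q (extId f)

/-- `f ∈ C^q(ℝ₊², ℝ₊)`: `ℝ₊`-valued and `q`-times continuously differentiable on the
quadrant (one-sided at the boundary). -/
def memCqTwo (q : ℕ) (f : ℝ → ℝ → ℝ) : Prop :=
  (∀ u ∈ Ici (0:ℝ), ∀ t ∈ Ici (0:ℝ), 0 ≤ f u t) ∧
  ContDiffOn ℝ q (fun p : ℝ × ℝ => f p.1 p.2) (Ici 0 ×ˢ Ici 0)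

/-- the matrix `M(ρ)`. -/
def Mmat {I : ℕ} (ρ : Fin I → ℝ) : Matrix (Fin I) (Fin I) ℝ :=
  Matrix.of fun i j =>
    if i = j then 1 - ∑ k ∈ Finset.univ.erase i, 2 * min (sz i) (sz k) * ρ k
    else 2 * min (sz i) (sz j) * ρ j

/-- the effective speeds `v^eff(ρ) = M(ρ)⁻¹ v`, where `v_i = i`. -/
def veff {I : ℕ} (ρ : Fin I → ℝ) : Fin I → ℝ :=
  ((Mmat ρ)⁻¹).mulVec fun i => sz i

/-- `ρ ∈ 𝒟_density`. -/
def memDdensity {I : ℕ} (ρ : Fin I → ℝ → ℝ) : Prop :=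
  (∀ i, (∀ u ∈ Ici (0:ℝ), 0 ≤ ρ i u) ∧ ContDiff ℝ 1 (extZ (ρ i))) ∧
  (∀ u ∈ Ici (0:ℝ), ∑ i, 2 * sz i * ρ i u < 1) ∧
  ∃ c : Fin I → ℝ,
    (∀ i, ∀ u ∈ Ici (0:ℝ),
      ρ i u ≤ c i * (1 - ∑ j, 2 * min (sz i) (sz j) * ρ j u)) ∧
    ∑ i, sz i * c i < 1 / 2

theorem memC.comp {f g : ℝ → ℝ} (hf : memC f) (hg : memC g) : memC (f ∘ g) :=
  ⟨hf.1.comp hg.1 hg.2.2.2, hf.2.1.comp hg.2.1 hg.2.2.2, by simp [hg.2.2.1, hf.2.2.1],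
    fun u hu => hf.2.2.2 _ (hg.2.2.2 u hu)⟩

theorem memC.sum {ι : Type*} {s : Finset ι} {c : ι → ℝ} {f : ι → ℝ → ℝ}
    (hc : ∀ j ∈ s, 0 ≤ c j) (hf : ∀ j ∈ s, c j ≠ 0 → memC (f j)) :
    memC fun u => ∑ j ∈ s, c j * f j u := by
  have key : ∀ j ∈ s, memC fun u => c j * f j u := fun j hj => by
    by_cases h : c j = 0
    · simp only [h, zero_mul]
      exact ⟨continuousOn_const, monotoneOn_const, rfl, fun _ _ => le_rfl⟩
    · obtain ⟨h₁, h₂, h₃, h₄⟩ := hf j hj h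
      exact ⟨continuousOn_const.mul h₁, fun x hx y hy hxy =>
          mul_le_mul_of_nonneg_left (h₂ hx hy hxy) (hc j hj), by simp [h₃],
        fun u hu => mul_nonneg (hc j hj) (h₄ u hu)⟩
  exact ⟨continuousOn_finsetSum _ fun j hj => (key j hj).1,
    fun x hx y hy hxy => Finset.sum_le_sum fun j hj => (key j hj).2.1 hx hy hxy,
    Finset.sum_eq_zero fun j hj => (key j hj).2.2.1,
    fun u hu => Finset.sum_nonneg fun j hj => (key j hj).2.2.2 u hu⟩

theorem memCup.add_memC {f g : ℝ → ℝ} (hf : memCup f) (hg : memC g) :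
    memCup fun u => f u + g u :=
  ⟨⟨hf.1.1.add hg.1, hf.1.2.1.add hg.2.1, by simp [hf.1.2.2.1, hg.2.2.1],
      fun u hu => add_nonneg (hf.1.2.2.2 u hu) (hg.2.2.2 u hu)⟩,
    hf.2.1.add_monotone hg.2.1,
    tendsto_atTop_mono' _ ((eventually_ge_atTop 0).mono fun u hu =>
      le_add_of_nonneg_right (hg.2.2.2 u hu)) hf.2.2⟩

theorem memCup_id : memCup fun z => z :=
  ⟨⟨continuousOn_id, monotoneOn_id, rfl, fun _ hu => hu⟩, strictMonoOn_id, tendsto_id⟩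

theorem memCup.congr {f g : ℝ → ℝ} (hf : memCup f) (h : EqOn f g (Ici 0)) : memCup g :=
  ⟨⟨hf.1.1.congr h.symm, hf.1.2.1.congr h, by rw [← h self_mem_Ici, hf.1.2.2.1],
      fun u hu => h hu ▸ hf.1.2.2.2 u hu⟩,
    hf.2.1.congr h, hf.2.2.congr' ((eventually_ge_atTop 0).mono fun _ hu => h hu)⟩

theorem memCup.comp {f g : ℝ → ℝ} (hf : memCup f) (hg : memCup g) : memCup (f ∘ g) :=
  ⟨hf.1.comp hg.1, hf.2.1.comp hg.2.1 hg.1.2.2.2, hf.2.2.comp hg.2.2⟩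

theorem memCup.bijOn {f : ℝ → ℝ} (hf : memCup f) : BijOn f (Ici 0) (Ici 0) := by
  refine ⟨hf.1.2.2.2, hf.2.1.injOn, fun y hy => ?_⟩
  obtain ⟨b, hb, hb'⟩ := ((hf.2.2.eventually_ge_atTop y).and (eventually_ge_atTop 0)).exists
  obtain ⟨x, hx, rfl⟩ := intermediate_value_Icc hb' (hf.1.1.mono Icc_subset_Ici_self)
    (show y ∈ Icc (f 0) (f b) from ⟨hf.1.2.2.1.symm ▸ hy, hb⟩)
  exact ⟨x, hx.1, rfl⟩

theorem memCup.rinv_apply {f : ℝ → ℝ} (hf : memCup f) {u : ℝ} (hu : 0 ≤ u) :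
    rinv f (f u) = u :=
  hf.bijOn.invOn_invFunOn.1 hu

theorem memCup.apply_rinv {f : ℝ → ℝ} (hf : memCup f) {z : ℝ} (hz : 0 ≤ z) :
    f (rinv f z) = z :=
  hf.bijOn.invOn_invFunOn.2 hz

theorem memCup.rinv {f : ℝ → ℝ} (hf : memCup f) : memCup (rinv f) := by
  have hmaps : MapsTo (_root_.rinv f) (Ici 0) (Ici 0) := hf.bijOn.surjOn.mapsTo_invFunOn
  have hmono : StrictMonoOn (_root_.rinv f) (Ici 0) := fun x hx y hy hxy => by
    rwa [← hf.2.1.lt_iff_lt (hmaps hx) (hmaps hy), hf.apply_rinv hx, hf.apply_rinv hy]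
  have hzero : _root_.rinv f 0 = 0 := by
    simpa [hf.1.2.2.1] using hf.rinv_apply le_rfl
  refine ⟨⟨?_, hmono.monotoneOn, hzero, fun _ hz => hmaps hz⟩, hmono, ?_⟩
  · rw [continuousOn_iff_continuous_domRestrict]
    have hcont : Continuous (hmaps.restrict _ _ _) :=
      Monotone.continuous_of_surjective
        (fun x y h => hmono.monotoneOn x.2 y.2 h)
        fun u => ⟨⟨f u, hf.1.2.2.2 u u.2⟩, Subtype.ext (hf.rinv_apply u.2)⟩
    exact continuous_subtype_val.comp hcont
  · refine tendsto_atTop.2 fun b => ?_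
    filter_upwards [eventually_ge_atTop (f (max b 0))] with z hz
    have hb : 0 ≤ max b 0 := le_max_right _ _
    have := hmono.monotoneOn (hf.1.2.2.2 _ hb) ((hf.1.2.2.2 _ hb).trans hz) hz
    rw [hf.rinv_apply hb] at this
    exact (le_max_left _ _).trans this

/-- `φ_i` for a natural number `i`, so that `φ_0` is the identity. -/
def phiNat {I : ℕ} (ψ : Fin I → ℝ → ℝ) (i : ℕ) (u : ℝ) : ℝ :=
  u - ∑ j, 2 * min (i : ℝ) (sz j) * ψ j u

theorem sz_le {I : ℕ} (j : Fin I) : sz j ≤ I := by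
  unfold sz; exact_mod_cast j.2

theorem phiNat_zero {I : ℕ} (ψ : Fin I → ℝ → ℝ) (u : ℝ) : phiNat ψ 0 u = u := by
  have (j : Fin I) : (0 : ℝ) ≤ sz j := by unfold sz; positivity
  simp [phiNat, this]

theorem phiNat_succ {I : ℕ} (ψ : Fin I → ℝ → ℝ) (i : Fin I) :
    phiNat ψ (i + 1) = phi ψ i := by
  ext u; simp [phiNat, phi, sz]

theorem phiNat_top {I : ℕ} (ψ : Fin I → ℝ → ℝ) : phiNat ψ I = phiTop ψ := by
  ext u; simp [phiNat, phiTop, sz_le]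

theorem phiNat_eq {I : ℕ} (ψ : Fin I → ℝ → ℝ) (i : ℕ) (u : ℝ) :
    phiNat ψ i u = phiTop ψ u + ∑ j, 2 * (sz j - min (i : ℝ) (sz j)) * ψ j u := by
  simp only [phiNat, phiTop, mul_sub, sub_mul, Finset.sum_sub_distrib]
  ring

theorem memF.phiNat {I : ℕ} {ψ : Fin I → ℝ → ℝ} (hψ : memF ψ) (i : ℕ) :
    memCup (phiNat ψ i) := by
  rw [funext (phiNat_eq ψ i)]
  exact hψ.2.add_memC <| memC.sum (fun j _ => by linarith [min_le_right (i : ℝ) (sz j)])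
    fun j _ _ => hψ.1 j

theorem sz_sub_min_eq_zero {I : ℕ} {i : ℕ} {j : Fin I} (h : ¬ i ≤ j) :
    sz j - min (i : ℝ) (sz j) = 0 := by
  rw [min_eq_right, sub_self]
  unfold sz
  exact_mod_cast not_le.1 h

theorem gam_eq {I : ℕ} (ψb : Fin I → ℝ → ℝ) {i : ℕ} (hi : i ≤ I) (z : ℝ) :
    gam ψb i z = z + ∑ j : Fin I, 2 * (sz j - min (i : ℝ) (sz j)) * ψb j (gam ψb (j + 1) z) := by
  rw [gam]
  rcases hk : I - i with _ | k
  · rw [gammaK, Finset.sum_eq_zero, add_zero]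
    exact fun j _ => by rw [sz_sub_min_eq_zero (by omega), mul_zero, zero_mul]
  · rw [gammaK]
    dsimp only
    congr 1
    refine Finset.sum_of_injOn (fun m => (⟨I - 1 - m, by omega⟩ : Fin I)) ?_ (fun _ _ => by simp) ?_ ?_
    · rintro ⟨m, hm⟩ - ⟨n, hn⟩ - h
      rw [Finset.mem_range] at hm hn
      simp only [Fin.mk.injEq] at h
      exact Subtype.ext (by dsimp only; omega)
    · intro j _ hj
      rw [sz_sub_min_eq_zero, mul_zero, zero_mul]
      refine fun hij => hj ⟨⟨I - 1 - j, Finset.mem_range.2 (by omega)⟩, by simp, ?_⟩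
      exact Fin.ext (by dsimp only; omega)
    · rintro ⟨m, hm⟩ -
      rw [Finset.mem_range] at hm
      have hmI : m < I := by omega
      have hgam : gam ψb (I - 1 - m + 1) = gammaK ψb m := by
        rw [gam]
        congr 1
        omega
      have hsz : sz (⟨I - 1 - m, by omega⟩ : Fin I) = I - m := by
        simp only [sz]
        rw [Nat.sub_right_comm, Nat.cast_sub (by omega), Nat.cast_sub (by omega)]
        simp
      have him : (i : ℝ) ≤ I - m := by
        rw [← Nat.cast_sub hmI.le]
        exact_mod_cast (by omega)
      have hki : ((k + 1 : ℕ) : ℝ) = I - i := by rw [← hk, Nat.cast_sub hi]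
      rw [dif_pos hmI, hgam, hsz, min_eq_left him, hki]
      ring

/-- Downward induction along the recursion defining `γ_i`. -/
theorem gam_induction {I : ℕ} {P : ℕ → Prop}
    (h : ∀ i ≤ I, (∀ j : Fin I, i ≤ j → P (j + 1)) → P i) {i : ℕ} (hi : i ≤ I) : P i := by
  induction k : I - i using Nat.strong_induction_on generalizing i with
  | _ k ih =>
    exact h i hi fun j hj => ih (I - (j + 1)) (by omega) (by omega) rfl

theorem memCup_gam {I : ℕ} {ψb : Fin I → ℝ → ℝ} (h : ∀ i, memC (ψb i)) {i : ℕ} (hi : i ≤ I) :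
    memCup (gam ψb i) := by
  refine gam_induction (P := fun i => memCup (gam ψb i)) (fun i hi ih => ?_) hi
  rw [funext (gam_eq ψb hi)]
  refine memCup_id.add_memC <| memC.sum (f := fun j z => ψb j (gam ψb (j + 1) z))
    (fun j _ => by linarith [min_le_right (i : ℝ) (sz j)])
    fun j _ hj => (h j).comp (ih j ?_).1
  by_contra hij
  exact hj (by rw [sz_sub_min_eq_zero hij, mul_zero])

theorem memF.gam_Upsilon_phiTop {I : ℕ} {ψ : Fin I → ℝ → ℝ} (hψ : memF ψ) {i : ℕ} (hi : i ≤ I)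
    {u : ℝ} (hu : 0 ≤ u) : gam (Upsilon ψ) i (phiTop ψ u) = _root_.phiNat ψ i u := by
  refine gam_induction (P := fun i => gam (Upsilon ψ) i (phiTop ψ u) = _root_.phiNat ψ i u)
    (fun i hi ih => ?_) hi
  rw [gam_eq _ hi, phiNat_eq]
  congr 1
  refine Finset.sum_congr rfl fun j _ => ?_
  by_cases hij : i ≤ j
  · have := hψ.phiNat (j + 1)
    rw [ih j hij, Upsilon, Function.comp_apply, ← phiNat_succ, this.rinv_apply hu]
  · simp [sz_sub_min_eq_zero hij]

theorem memF.memC_Upsilon {I : ℕ} {ψ : Fin I → ℝ → ℝ} (hψ : memF ψ) (i : Fin I) :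
    memC (Upsilon ψ i) :=
  (hψ.1 i).comp (phiNat_succ ψ i ▸ hψ.phiNat (i + 1)).rinv.1

theorem memF.Gamma_Upsilon {I : ℕ} {ψ : Fin I → ℝ → ℝ} (hψ : memF ψ) (i : Fin I) :
    EqOn (Gamma (Upsilon ψ) i) (ψ i) (Ici 0) := fun u hu => by
  have h0 : rinv (gam (Upsilon ψ) 0) u = phiTop ψ u := by
    have := (memCup_gam hψ.memC_Upsilon (Nat.zero_le I)).rinv_apply (hψ.2.1.2.2.2 u hu)
    rwa [hψ.gam_Upsilon_phiTop (Nat.zero_le I) hu, phiNat_zero] at this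
  simp only [Gamma, Function.comp_apply]
  rw [h0, hψ.gam_Upsilon_phiTop i.2 hu, Upsilon, Function.comp_apply, ← phiNat_succ,
    (hψ.phiNat (i + 1)).rinv_apply hu]

theorem phiNat_Gamma_gam {I : ℕ} {ψb : Fin I → ℝ → ℝ} (h : ∀ i, memC (ψb i)) {i : ℕ} (hi : i ≤ I)
    {z : ℝ} (hz : 0 ≤ z) : phiNat (Gamma ψb) i (gam ψb 0 z) = gam ψb i z := by
  have hΓ (j : Fin I) : Gamma ψb j (gam ψb 0 z) = ψb j (gam ψb (j + 1) z) := by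
    simp only [Gamma, Function.comp_apply, (memCup_gam h (Nat.zero_le I)).rinv_apply hz]
  have hsz (j : Fin I) : (0 : ℝ) ≤ sz j := by unfold sz; positivity
  simp only [phiNat, hΓ]
  rw [gam_eq ψb (Nat.zero_le I), gam_eq ψb hi]
  simp only [mul_sub, sub_mul, Finset.sum_sub_distrib, Nat.cast_zero, min_eq_left (hsz _), mul_zero,
    zero_mul, Finset.sum_const_zero]
  ring

theorem phiNat_Gamma {I : ℕ} {ψb : Fin I → ℝ → ℝ} (h : ∀ i, memC (ψb i)) {i : ℕ} (hi : i ≤ I) :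
    EqOn (gam ψb i ∘ rinv (gam ψb 0)) (phiNat (Gamma ψb) i) (Ici 0) := fun u hu => by
  have h0 := memCup_gam h (Nat.zero_le I)
  rw [Function.comp_apply, ← phiNat_Gamma_gam h hi (h0.rinv.1.2.2.2 u hu), h0.apply_rinv hu]

theorem memCup_phiNat_Gamma {I : ℕ} {ψb : Fin I → ℝ → ℝ} (h : ∀ i, memC (ψb i)) {i : ℕ}
    (hi : i ≤ I) : memCup (phiNat (Gamma ψb) i) :=
  ((memCup_gam h hi).comp (memCup_gam h (Nat.zero_le I)).rinv).congr (phiNat_Gamma h hi)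

theorem memF_Gamma {I : ℕ} {ψb : Fin I → ℝ → ℝ} (h : ∀ i, memC (ψb i)) : memF (Gamma ψb) :=
  ⟨fun i => (h i).comp ((memCup_gam h i.2).1.comp (memCup_gam h (Nat.zero_le I)).rinv.1),
    phiNat_top (Gamma ψb) ▸ memCup_phiNat_Gamma h le_rfl⟩

theorem Upsilon_Gamma {I : ℕ} {ψb : Fin I → ℝ → ℝ} (h : ∀ i, memC (ψb i)) (i : Fin I) :
    EqOn (Upsilon (Gamma ψb) i) (ψb i) (Ici 0) := fun z hz => by
  have hφ := memCup_phiNat_Gamma h (i := i + 1) i.2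
  rw [Upsilon, Function.comp_apply, ← phiNat_succ, Gamma, Function.comp_apply,
    phiNat_Gamma h i.2 (hφ.rinv.1.2.2.2 z hz), hφ.apply_rinv hz]

/-- `Υ` is a bijection from `𝓕` onto `𝒞^I` with inverse `Γ`:
`Υ` maps `𝓕` into `𝒞^I` with `Γ(Υ(ψ)) = ψ` on `ℝ₊`, and `Γ` maps `𝒞^I` into `𝓕`
with `Υ(Γ(ψb)) = ψb` on `ℝ₊`. -/
theorem stmt_5 {I : ℕ} (hI : 1 ≤ I) :
    (∀ ψ : Fin I → ℝ → ℝ, memF ψ →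
      (∀ i, memC (Upsilon ψ i)) ∧ ∀ i, EqOn (Gamma (Upsilon ψ) i) (ψ i) (Ici 0)) ∧
    (∀ ψb : Fin I → ℝ → ℝ, (∀ i, memC (ψb i)) →
      memF (Gamma ψb) ∧ ∀ i, EqOn (Upsilon (Gamma ψb) i) (ψb i) (Ici 0)) := by
  exact ⟨fun ψ hψ => ⟨hψ.memC_Upsilon, hψ.Gamma_Upsilon⟩,
    fun ψb h => ⟨memF_Gamma h, Upsilon_Gamma h⟩⟩
end
end

section
/- Let q ≥ 1 be an integer and ψ ∈ 𝒟^q. Then for every i = 1, …, I: (i) φ_i ∈ 𝒞^{↑,q}; (ii) φ_i'(u) > 0 for all u ∈ ℝ₊. Moreover, ∑_{i=1}^I i ψ_i'(u) < 1/2 for all u ∈ ℝ₊. -/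
open Set Filter

noncomputable section

lemma sz_le_sz {I : ℕ} {i j : Fin I} (h : i ≤ j) : sz i ≤ sz j := by
  have : ((i : ℕ) : ℝ) ≤ ((j : ℕ) : ℝ) := by exact_mod_cast h
  unfold sz; linarith

lemma eqOn_extZ (f : ℝ → ℝ) : EqOn f (extZ f) (Ici 0) := fun _ hu => (if_pos hu).symm

lemma eqOn_extId (f : ℝ → ℝ) : EqOn f (extId f) (Ici 0) := fun _ hu => (if_pos hu).symm

lemma extId_phi {I : ℕ} (ψ : Fin I → ℝ → ℝ) (i : Fin I) :
    extId (phi ψ i) = fun u => u - ∑ j, 2 * min (sz i) (sz j) * extZ (ψ j) u := by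
  funext u
  by_cases hu : 0 ≤ u <;> simp [extId, extZ, phi, hu]

/-- `φ_i` exceeds `φ_I` by a nonnegative combination of the `ψ_j`. -/
lemma phi_eq_phiTop_add {I : ℕ} (ψ : Fin I → ℝ → ℝ) (i : Fin I) (u : ℝ) :
    phi ψ i u = phiTop ψ u + ∑ j, 2 * (sz j - min (sz i) (sz j)) * ψ j u := by
  have : ∑ j, 2 * (sz j - min (sz i) (sz j)) * ψ j u =
      ∑ j, 2 * sz j * ψ j u - ∑ j, 2 * min (sz i) (sz j) * ψ j u := by
    rw [← Finset.sum_sub_distrib]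
    exact Finset.sum_congr rfl fun j _ => by ring
  rw [this, phi, phiTop]; ring

lemma two_mul_sub_min_nonneg {I : ℕ} (i j : Fin I) : 0 ≤ 2 * (sz j - min (sz i) (sz j)) := by
  linarith [min_le_right (sz i) (sz j)]

lemma memCup_phi {I : ℕ} {ψ : Fin I → ℝ → ℝ} (h : memF ψ) (i : Fin I) : memCup (phi ψ i) := by
  obtain ⟨hψ, ⟨-, -, -, hpos⟩, hmono, htop⟩ := h
  have hstrict : StrictMonoOn (phi ψ i) (Ici 0) := fun u hu v hv huv => by
    rw [phi_eq_phiTop_add, phi_eq_phiTop_add]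
    refine add_lt_add_of_lt_of_le (hmono hu hv huv) (Finset.sum_le_sum fun j _ => ?_)
    exact mul_le_mul_of_nonneg_left ((hψ j).2.1 hu hv huv.le) (two_mul_sub_min_nonneg i j)
  have hle : ∀ u ∈ Ici (0 : ℝ), phiTop ψ u ≤ phi ψ i u := fun u hu => by
    rw [phi_eq_phiTop_add]
    exact le_add_of_nonneg_right <| Finset.sum_nonneg fun j _ =>
      mul_nonneg (two_mul_sub_min_nonneg i j) ((hψ j).2.2.2 u hu)
  refine ⟨⟨?_, hstrict.monotoneOn, ?_, fun u hu => (hpos u hu).trans (hle u hu)⟩, hstrict, ?_⟩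
  · exact continuousOn_id.sub <| continuousOn_finsetSum _ fun j _ =>
      continuousOn_const.mul (hψ j).1
  · simp [phi, (hψ _).2.2.1]
  · exact tendsto_atTop_mono' _ ((eventually_ge_atTop 0).mono hle) htop

lemma deriv_nonneg_of_monotoneOn_Ici {f : ℝ → ℝ} {a x : ℝ} (hf : MonotoneOn f (Ici a))
    (hx : x ∈ Ici a) (hd : DifferentiableAt ℝ f x) : 0 ≤ deriv f x := by
  rw [← hd.derivWithin (uniqueDiffOn_Ici a x hx)]
  exact hf.derivWithin_nonneg

/-- If `∑ 2 j p_j ≤ 1` and each `p_i` is dominated by a multiple of the slot density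
`1 - ∑ 2 (i ∧ j) p_j`, then the first inequality is strict. -/
lemma sum_sz_mul_lt_half {I : ℕ} {p c : Fin I → ℝ} (hp : ∀ i, 0 ≤ p i)
    (hle : ∑ j, sz j * p j ≤ 1 / 2)
    (hc : ∀ i, p i ≤ c i * (1 - ∑ j, 2 * min (sz i) (sz j) * p j)) :
    ∑ j, sz j * p j < 1 / 2 := by
  refine lt_of_le_of_ne hle fun heq => ?_
  have hne : (Finset.univ.filter fun i => p i ≠ 0).Nonempty := by
    by_contra! hempty
    have h0 : ∀ i, p i = 0 := by simpa [Finset.filter_eq_empty_iff] using hempty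
    simp [h0] at heq
  obtain ⟨i, hi, hmax⟩ := Finset.exists_max_image _ id hne
  have hsum : ∑ j, 2 * min (sz i) (sz j) * p j = 2 * ∑ j, sz j * p j := by
    rw [Finset.mul_sum]
    refine Finset.sum_congr rfl fun j _ => ?_
    by_cases hj : p j = 0
    · simp [hj]
    · rw [min_eq_right (sz_le_sz (i := j) (j := i) (hmax j (by simpa using hj)))]; ring
  have hpi := hc i
  rw [hsum, heq] at hpi
  norm_num at hpi
  exact (Finset.mem_filter.1 hi).2 (le_antisymm hpi (hp i))

/-- for `ψ ∈ 𝒟^q`: (i) `φ_i ∈ 𝒞^{↑,q}`; (ii) `φ_i'(u) > 0` for all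
`u ∈ ℝ₊`; moreover `∑_i i ψ_i'(u) < 1/2` for all `u ∈ ℝ₊`. -/
theorem stmt_11 {I : ℕ} (hI : 1 ≤ I) (q : ℕ) (hq : 1 ≤ q) (ψ : Fin I → ℝ → ℝ)
    (hD : memD ψ) (hCq : ∀ i, memCq q (ψ i)) :
    (∀ i, memCupq q (phi ψ i)) ∧
    (∀ i, ∀ u ∈ Ici (0:ℝ), 0 < deriv (extId (phi ψ i)) u) ∧
    (∀ u ∈ Ici (0:ℝ), ∑ i, sz i * deriv (extZ (ψ i)) u < 1 / 2) := by
  obtain ⟨hF, c, hc, -⟩ := hD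
  have hq0 : (q : WithTop ℕ∞) ≠ 0 := by exact_mod_cast (by omega : q ≠ 0)
  have hdiff : ∀ j, Differentiable ℝ (extZ (ψ j)) := fun j => (hCq j).2.differentiable hq0
  have hphi : ∀ i u, HasDerivAt (extId (phi ψ i))
      (1 - ∑ j, 2 * min (sz i) (sz j) * deriv (extZ (ψ j)) u) u := fun i u => by
    rw [extId_phi]
    exact (hasDerivAt_id' u).sub <| HasDerivAt.fun_sum fun j _ =>
      (hdiff j u).hasDerivAt.const_mul _
  have hp : ∀ u ∈ Ici (0 : ℝ), ∀ j, 0 ≤ deriv (extZ (ψ j)) u := fun u hu j =>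
    deriv_nonneg_of_monotoneOn_Ici ((hF.1 j).2.1.congr (eqOn_extZ _)) hu (hdiff j u)
  have hlt : ∀ u ∈ Ici (0 : ℝ), ∑ i, sz i * deriv (extZ (ψ i)) u < 1 / 2 := by
    intro u hu
    refine sum_sz_mul_lt_half (c := c) (hp u hu) ?_ fun i => ?_
    · have hd : HasDerivAt (fun v => v - ∑ j, 2 * sz j * extZ (ψ j) v)
          (1 - ∑ j, 2 * sz j * deriv (extZ (ψ j)) u) u :=
        (hasDerivAt_id' u).sub <| HasDerivAt.fun_sum fun j _ =>
          (hdiff j u).hasDerivAt.const_mul _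
      have hm := deriv_nonneg_of_monotoneOn_Ici (hF.2.1.2.1.congr fun v hv => by
        simp only [phiTop, fun j => eqOn_extZ (ψ j) hv]) hu hd.differentiableAt
      rw [hd.deriv] at hm
      simp only [mul_assoc, ← Finset.mul_sum] at hm
      linarith
    · have hd := ((hphi i u).const_mul (c i)).sub (hdiff i u).hasDerivAt
      have hm : MonotoneOn (fun v => c i * phi ψ i v - ψ i v) (Ici 0) := fun v hv w hw hvw => by
        rcases hvw.eq_or_lt with rfl | hvw
        · exact le_rfl
        · have := hc i w hw v hv hvw
          simp only
          linarith
      have := deriv_nonneg_of_monotoneOn_Ici (hm.congr fun v hv => by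
        simp only [Pi.sub_apply, eqOn_extId (phi ψ i) hv, eqOn_extZ (ψ i) hv]) hu
        hd.differentiableAt
      rw [hd.deriv] at this
      linarith
  refine ⟨fun i => ⟨memCup_phi hF i, ?_⟩, fun i u hu => ?_, hlt⟩
  · rw [extId_phi]
    exact contDiff_id.sub <| ContDiff.sum fun j _ => contDiff_const.mul (hCq j).2
  · rw [(hphi i u).deriv]
    have hle : ∑ j, 2 * min (sz i) (sz j) * deriv (extZ (ψ j)) u ≤
        2 * ∑ j, sz j * deriv (extZ (ψ j)) u := by
      rw [Finset.mul_sum]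
      refine Finset.sum_le_sum fun j _ => ?_
      rw [← mul_assoc]
      exact mul_le_mul_of_nonneg_right (by linarith [min_le_right (sz i) (sz j)]) (hp u hu j)
    linarith [hlt u hu]
end
end
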